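/- For every finite simple graph G with at least one edge, β(G) equals the maximum size of a minimal S-face of the independence complex Ind(G). -/

import Mathlib

/-- `A` is an independent set of `G`. -/
def IsIndepSet' {V : Type*} (G : SimpleGraph V) (A : Set V) : Prop :=
  ∀ x ∈ A, ∀ y ∈ A, ¬ G.Adj x y

/-- The independence complex `Ind(G)`: faces are the independent sets of `G`. -/
def indComplex {V : Type*} (G : SimpleGraph V) : Set (Set V) :=
  {S | IsIndepSet' G S}

/-- The link `lk_Δ(A) = {F ∈ Δ : F ∩ A = ∅ and F ∪ A ∈ Δ}` of a face `A` in `Δ`. -/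
def link {V : Type*} (Δ : Set (Set V)) (A : Set V) : Set (Set V) :=
  {F | F ∈ Δ ∧ F ∩ A = ∅ ∧ F ∪ A ∈ Δ}

/-- `A` is an `S`-face of `Δ`: `A` is a face whose link is a simplex, i.e. the union
of all faces of the link is itself a face of the link. -/
def IsSFace {V : Type*} (Δ : Set (Set V)) (A : Set V) : Prop :=
  A ∈ Δ ∧ ⋃₀ (link Δ A) ∈ link Δ A

/-- `A` is a minimal `S`-face of `Δ`: no proper subset of `A` is an `S`-face. -/
def IsMinSFace {V : Type*} (Δ : Set (Set V)) (A : Set V) : Prop :=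
  IsSFace Δ A ∧ ∀ B ⊂ A, ¬ IsSFace Δ B

/-- The vertex `u` vertex-wise dominates the edge `e` in `G`: `u` belongs to the closed
neighbourhood of the set of endpoints of `e`. -/
def VWDominates {V : Type*} (G : SimpleGraph V) (u : V) (e : Sym2 V) : Prop :=
  ∃ x ∈ e, u = x ∨ G.Adj u x

/-- `S` is a vertex-wise dominating set of `G`. -/
def IsVWDomSet {V : Type*} (G : SimpleGraph V) (S : Set V) : Prop :=
  ∀ e ∈ G.edgeSet, ∃ u ∈ S, VWDominates G u e

/-- `S` is a minimal vertex-wise dominating set of `G`. -/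
def IsMinVWDomSet {V : Type*} (G : SimpleGraph V) (S : Set V) : Prop :=
  IsVWDomSet G S ∧ ∀ T ⊂ S, ¬ IsVWDomSet G T

/-- The upper independent vertex-wise domination number `β(G)`: the maximum size of a
minimal vertex-wise dominating set of `G` that is also an independent set. -/
noncomputable def upperIndVWDomNum {V : Type*} (G : SimpleGraph V) : ℕ :=
  sSup {n | ∃ S : Set V, IsIndepSet' G S ∧ IsMinVWDomSet G S ∧ S.ncard = n}

theorem sUnion_link_indComplex {V : Type*} (G : SimpleGraph V) {A : Set V}
    (hA : IsIndepSet' G A) :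
    ⋃₀ (link (indComplex G) A) = {v | ∀ u ∈ A, u ≠ v ∧ ¬ G.Adj u v} := by
  ext v
  constructor
  · rintro ⟨F, ⟨-, hd, hF⟩, hv⟩ u hu
    refine ⟨?_, hF u (Or.inr hu) v (Or.inl hv)⟩
    rintro rfl
    exact (Set.disjoint_iff_inter_eq_empty.mpr hd).notMem_of_mem_left hv hu
  · intro hv
    refine ⟨{v}, ⟨?_, ?_, ?_⟩, rfl⟩
    · rintro x rfl y rfl
      exact G.irrefl
    · exact Set.singleton_inter_eq_empty.mpr fun h => (hv v h).1 rfl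
    · rintro x (rfl | hx) y (rfl | hy) h
      · exact G.irrefl h
      · exact (hv y hy).2 h.symm
      · exact (hv x hx).2 h
      · exact hA x hx y hy h

theorem isSFace_indComplex_iff {V : Type*} (G : SimpleGraph V) (A : Set V) :
    IsSFace (indComplex G) A ↔ IsIndepSet' G A ∧ IsVWDomSet G A := by
  refine and_congr_right fun hA => ?_
  have hA : IsIndepSet' G A := hA
  rw [sUnion_link_indComplex G hA]
  constructor
  · rintro ⟨hW, -, -⟩ e he
    induction e using Sym2.ind with
    | _ x y =>
      by_contra hdom
      have key : ∀ z ∈ s(x, y), ∀ u ∈ A, u ≠ z ∧ ¬ G.Adj u z := fun z hz u hu =>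
        not_or.mp fun h => hdom ⟨u, hu, z, hz, h⟩
      exact hW x (key x (Sym2.mem_mk_left x y)) y (key y (Sym2.mem_mk_right x y)) he
  · intro hdom
    have hW : IsIndepSet' G {v | ∀ u ∈ A, u ≠ v ∧ ¬ G.Adj u v} := by
      intro x hx y hy hxy
      obtain ⟨u, hu, z, hz, h⟩ := hdom s(x, y) hxy
      rcases Sym2.mem_iff.mp hz with rfl | rfl
      · exact not_or.mpr (hx u hu) h
      · exact not_or.mpr (hy u hu) h
    refine ⟨hW, ?_, ?_⟩
    · exact Set.eq_empty_of_forall_notMem fun v hv => (hv.1 v hv.2).1 rfl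
    · rintro x (hx | hx) y (hy | hy) h
      · exact hW x hx y hy h
      · exact (hx y hy).2 h.symm
      · exact (hy x hx).2 h
      · exact hA x hx y hy h

theorem isMinSFace_indComplex_iff {V : Type*} (G : SimpleGraph V) (A : Set V) :
    IsMinSFace (indComplex G) A ↔ IsIndepSet' G A ∧ IsMinVWDomSet G A := by
  unfold IsMinSFace IsMinVWDomSet
  simp only [isSFace_indComplex_iff, and_assoc]
  refine and_congr_right fun hA => and_congr_right fun _ => forall₂_congr fun B hB => ?_
  have hB' : IsIndepSet' G B := fun x hx y hy => hA x (hB.1 hx) y (hB.1 hy)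
  simp [hB']

/-- For every finite simple graph `G` with at least one edge, `β(G)` equals the maximum
size of a minimal `S`-face of the independence complex `Ind(G)`. -/
theorem stmt10 {V : Type*} [Fintype V] (G : SimpleGraph V)
    (hedge : G.edgeSet.Nonempty) :
    upperIndVWDomNum G =
      sSup {n | ∃ L : Set V, IsMinSFace (indComplex G) L ∧ L.ncard = n} := by
  simp only [upperIndVWDomNum, isMinSFace_indComplex_iff, and_assoc]
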